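/- Let λ ∈ (0,1), let σ : ℝ → [0,1] be a measurable function vanishing on (−1/λ, 1), and define ψ on (−1/λ, 1) by log ψ(z) = ∫_{ℝ ∖ (−1/λ, 1)} σ(t)·[1/t − 1/(t−z)] dt. Then ψ(−1) ≤ 2·ψ(−λ). -/

import Mathlib

open MeasureTheory Set Real Filter

noncomputable section

lemma hasDerivAt_log_add_sub_log_add {p q t : ℝ} (hp : t + p ≠ 0) (hq : t + q ≠ 0) :
    HasDerivAt (fun t : ℝ => log (t + p) - log (t + q)) (1 / (t + p) - 1 / (t + q)) t :=
  (((hasDerivAt_id t).add_const p).log hp).sub (((hasDerivAt_id t).add_const q).log hq)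

lemma tendsto_log_add_sub_log_add (p q : ℝ) :
    Tendsto (fun t : ℝ => log (t + p) - log (t + q)) atTop (nhds 0) := by
  simpa using (tendsto_log_comp_add_sub_log p).sub (tendsto_log_comp_add_sub_log q)

lemma one_div_add_sub_one_div_add_nonneg {p q t : ℝ} (hpq : p ≤ q) (hp : 0 < t + p) :
    0 ≤ 1 / (t + p) - 1 / (t + q) :=
  sub_nonneg.2 (one_div_le_one_div_of_le hp (by linarith))

lemma integrableOn_Ioi_one_div_add_sub_one_div_add {p q c : ℝ} (hpq : p ≤ q) (hc : 0 < c + p) :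
    IntegrableOn (fun t : ℝ => 1 / (t + p) - 1 / (t + q)) (Ioi c) := by
  refine integrableOn_Ioi_deriv_of_nonneg' (fun t ht => ?_) (fun t ht => ?_)
    (tendsto_log_add_sub_log_add p q)
  · have := mem_Ici.1 ht
    exact hasDerivAt_log_add_sub_log_add (by linarith) (by linarith)
  · have := mem_Ioi.1 ht
    exact one_div_add_sub_one_div_add_nonneg hpq (by linarith)

lemma integral_Ioi_one_div_add_sub_one_div_add {p q c : ℝ} (hpq : p ≤ q) (hc : 0 < c + p) :
    ∫ t in Ioi c, (1 / (t + p) - 1 / (t + q)) = log (c + q) - log (c + p) := by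
  rw [integral_Ioi_of_hasDerivAt_of_tendsto' (fun t ht => ?_)
    (integrableOn_Ioi_one_div_add_sub_one_div_add hpq hc) (tendsto_log_add_sub_log_add p q)]
  · ring
  · have := mem_Ici.1 ht
    exact hasDerivAt_log_add_sub_log_add (by linarith) (by linarith)

lemma one_div_neg_add_sub_one_div_neg_add (p q t : ℝ) :
    1 / (-t + p) - 1 / (-t + q) = 1 / (t + -q) - 1 / (t + -p) := by
  rw [show -t + p = -(t + -p) by ring, show -t + q = -(t + -q) by ring, one_div_neg_eq_neg_one_div,
    one_div_neg_eq_neg_one_div]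
  ring

lemma integrableOn_Iic_one_div_add_sub_one_div_add {p q c : ℝ} (hpq : p ≤ q) (hc : q < c) :
    IntegrableOn (fun t : ℝ => 1 / (t + p) - 1 / (t + q)) (Iic (-c)) := by
  rw [integrableOn_Iic_iff_integrableOn_Iio]
  have h := (integrableOn_Ioi_one_div_add_sub_one_div_add (neg_le_neg hpq)
    (by linarith : 0 < c + -q))
  rw [← neg_neg c] at h
  simpa only [one_div_neg_add_sub_one_div_neg_add, neg_neg] using h.comp_neg_Iio

lemma integral_Iic_one_div_add_sub_one_div_add {p q c : ℝ} (hpq : p ≤ q) (hc : q < c) :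
    ∫ t in Iic (-c), (1 / (t + p) - 1 / (t + q)) = log (c - p) - log (c - q) := by
  rw [← integral_comp_neg_Ioi c (fun t : ℝ => 1 / (t + p) - 1 / (t + q))]
  simp only [one_div_neg_add_sub_one_div_neg_add]
  rw [integral_Ioi_one_div_add_sub_one_div_add (neg_le_neg hpq) (by linarith)]
  simp only [sub_eq_add_neg]

lemma compl_Ioo_eq_Iic_union_Ici (a b : ℝ) : (Ioo a b)ᶜ = Iic a ∪ Ici b := by
  ext t
  simp only [mem_compl_iff, mem_Ioo, mem_union, mem_Iic, mem_Ici, not_and_or, not_lt]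

/-- The two-sided kernel integral: with `σ = 1` the bound `ψ(-1) ≤ 2 ψ(-λ)` is an equality. -/
lemma integral_compl_Ioo_one_div_add_sub_one_div_add_one {lam : ℝ} (hlam : lam ∈ Ioo (0 : ℝ) 1) :
    IntegrableOn (fun t : ℝ => 1 / (t + lam) - 1 / (t + 1)) (Ioo (-1 / lam) 1)ᶜ ∧
      ∫ t in (Ioo (-1 / lam) (1 : ℝ))ᶜ, (1 / (t + lam) - 1 / (t + 1)) = log 2 := by
  obtain ⟨h0, h1⟩ := hlam
  have hinv : 1 < 1 / lam := by rwa [lt_div_iff₀ h0, one_mul]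
  have hleft := integrableOn_Iic_one_div_add_sub_one_div_add h1.le hinv
  have hright : IntegrableOn (fun t : ℝ => 1 / (t + lam) - 1 / (t + 1)) (Ici 1) := by
    rw [integrableOn_Ici_iff_integrableOn_Ioi]
    exact integrableOn_Ioi_one_div_add_sub_one_div_add h1.le (by linarith)
  rw [compl_Ioo_eq_Iic_union_Ici, neg_div]
  refine ⟨hleft.union hright, ?_⟩
  have hdisj : Disjoint (Iic (-(1 / lam))) (Ici (1 : ℝ)) :=
    disjoint_left.2 fun t ht ht' => by
      have := mem_Iic.1 ht
      have := mem_Ici.1 ht'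
      linarith
  rw [setIntegral_union hdisj measurableSet_Ici hleft hright, integral_Ici_eq_integral_Ioi,
    integral_Iic_one_div_add_sub_one_div_add h1.le hinv,
    integral_Ioi_one_div_add_sub_one_div_add h1.le (by linarith)]
  have hfac : 1 / lam - lam = (1 / lam - 1) * (1 + lam) := by
    field_simp
    ring
  rw [hfac, log_mul (by linarith) (by linarith), one_add_one_eq_two]
  ring

/-- Inequality (8.37): `ψ(-1) ≤ 2·ψ(-λ)` for `ψ` given by the integral
representation with `λ ∈ (0,1)`. -/
theorem psi_neg_one_le (lam : ℝ) (hlam : lam ∈ Set.Ioo (0:ℝ) 1)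
    (σ : ℝ → ℝ) (hσm : Measurable σ) (hσ01 : ∀ t, σ t ∈ Set.Icc (0:ℝ) 1)
    (hσ0 : ∀ t ∈ Set.Ioo (-1/lam) (1:ℝ), σ t = 0)
    (ψ : ℝ → ℝ)
    (hψpos : ∀ z ∈ Set.Ioo (-1/lam) (1:ℝ), 0 < ψ z)
    (hint : ∀ z ∈ Set.Ioo (-1/lam) (1:ℝ),
      IntegrableOn (fun t => σ t * (1/t - 1/(t - z))) (Set.Ioo (-1/lam) (1:ℝ))ᶜ)
    (hψ : ∀ z ∈ Set.Ioo (-1/lam) (1:ℝ),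
      Real.log (ψ z) = ∫ t in (Set.Ioo (-1/lam) (1:ℝ))ᶜ, σ t * (1/t - 1/(t - z))) :
    ψ (-1) ≤ 2 * ψ (-lam) := by
  have hker := integral_compl_Ioo_one_div_add_sub_one_div_add_one hlam
  obtain ⟨h0, h1⟩ := hlam
  have hinv : -1 / lam < -1 := by rw [div_lt_iff₀ h0]; linarith
  have hone : (-1 : ℝ) ∈ Ioo (-1 / lam) (1 : ℝ) := ⟨hinv, by norm_num⟩
  have hl : -lam ∈ Ioo (-1 / lam) (1 : ℝ) := ⟨by linarith, by linarith⟩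
  rw [← log_le_log_iff (hψpos _ hone) (mul_pos two_pos (hψpos _ hl)),
    log_mul two_ne_zero (hψpos _ hl).ne', ← sub_le_iff_le_add, hψ _ hone, hψ _ hl,
    ← integral_sub (hint _ hone) (hint _ hl), ← hker.2]
  refine setIntegral_mono_on ((hint _ hone).sub (hint _ hl)) hker.1 measurableSet_Ioo.compl
    fun t ht => ?_
  have hk : 0 ≤ 1 / (t + lam) - 1 / (t + 1) := by
    rw [compl_Ioo_eq_Iic_union_Ici] at ht
    rcases ht with ht | ht
    · have := mem_Iic.1 ht
      exact sub_nonneg.2 (one_div_le_one_div_of_neg_of_le (by linarith) (by linarith))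
    · have := mem_Ici.1 ht
      exact one_div_add_sub_one_div_add_nonneg h1.le (by linarith)
  calc σ t * (1 / t - 1 / (t - -1)) - σ t * (1 / t - 1 / (t - -lam))
      = σ t * (1 / (t + lam) - 1 / (t + 1)) := by simp only [sub_neg_eq_add]; ring
    _ ≤ 1 / (t + lam) - 1 / (t + 1) := mul_le_of_le_one_left hk (hσ01 t).2
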